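/- Let Σ_Λ = {Σ_λ = (γ_λ,f_λ,g_λ)}_{λ∈Λ} and h⁰, h ∈ H satisfy Assumption 1 with φ_λ(t,r) = p_λ(t)·r, where each p_λ : [0,∞) → R is Lebesgue measurable and locally integrable, and with α_λ(t,r) = d·r for a constant d ≥ 0. Suppose there exist κ > 0 and c ∈ R such that for all λ ∈ Λ every solution of the linear equation ẇ = −p_λ(t)w satisfies |w(t)| ≤ κ e^{−c(t−t_0)} |w(t_0)| for all t ≥ t_0 ≥ 0. If c > 0 and Γ_Λ = {γ_λ : λ ∈ Λ} ⊂ Γ_ADT[N_0,τ_D] for some N_0 ∈ N and some τ_D > max{ln(d)/c, 0} (any τ_D > 0 being admissible when d = 0, using the conventions 0·ln(0) = 0 and r·ln(0) = −∞ for r > 0), then Σ_Λ is strongly (h⁰,h)-ISS. -/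

import Mathlib

open MeasureTheory Filter Set
open scoped Classical

noncomputable section

/-- State/input spaces: `ℝ^k` with the Euclidean norm. -/
abbrev Stt (k : ℕ) : Type := EuclideanSpace ℝ (Fin k)

/-- An impulse-time sequence, identified with its (locally finite) set of impulse
times, a subset of `(0,∞)` with finitely many points below any bound. -/
def IsImpulseSeq (γ : Set ℝ) : Prop :=
  γ ⊆ Set.Ioi (0 : ℝ) ∧ ∀ T : ℝ, (γ ∩ Set.Iic T).Finite

/-- `n^γ_{(s,t]}`: the number of impulse times in the interval `(s,t]`. -/
def nJumps (γ : Set ℝ) (s t : ℝ) : ℕ := (γ ∩ Set.Ioc s t).ncard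

/-- Uniform incremental boundedness of a set of impulse-time sequences. -/
def UIB (S : Set (Set ℝ)) : Prop :=
  ∃ φ : ℝ → ℝ, ContinuousOn φ (Set.Ici 0) ∧ MonotoneOn φ (Set.Ici 0) ∧
    (∀ s : ℝ, 0 ≤ s → 0 ≤ φ s) ∧
    ∀ γ ∈ S, ∀ t0 t : ℝ, 0 ≤ t0 → t0 < t → (nJumps γ t0 t : ℝ) ≤ φ (t - t0)

/-- Class `K∞` functions `[0,∞) → [0,∞)`. -/
def ClassKInf (α : ℝ → ℝ) : Prop :=
  ContinuousOn α (Set.Ici 0) ∧ StrictMonoOn α (Set.Ici 0) ∧ α 0 = 0 ∧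
    ∀ M : ℝ, ∃ r : ℝ, 0 ≤ r ∧ M ≤ α r

/-- Class `KL` functions. -/
def ClassKL (β : ℝ → ℝ → ℝ) : Prop :=
  (∀ t : ℝ, 0 ≤ t → ClassKInf fun r => β r t) ∧
  ∀ r : ℝ, 0 ≤ r → AntitoneOn (fun t => β r t) (Set.Ici 0) ∧
    Filter.Tendsto (fun t => β r t) Filter.atTop (nhds 0)

/-- Positive definite functions `[0,∞) → [0,∞)`. -/
def PosDef (ρ : ℝ → ℝ) : Prop :=
  ContinuousOn ρ (Set.Ici 0) ∧ ρ 0 = 0 ∧ ∀ r : ℝ, 0 < r → 0 < ρ r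

/-- Locally integrable (on compacts) function `[0,∞) → ℝ` (extended to `ℝ`). -/
def LocIntegrable (p : ℝ → ℝ) : Prop :=
  ∀ a b : ℝ, MeasureTheory.IntegrableOn p (Set.Icc a b)

/-- Inputs: measurable, locally essentially bounded functions. -/
def IsInput {m : ℕ} (u : ℝ → Stt m) : Prop :=
  Measurable u ∧ ∀ T : ℝ, ∃ C : ℝ, ∀ᵐ t ∂MeasureTheory.volume, t ∈ Set.Icc 0 T → ‖u t‖ ≤ C

/-- `‖u_I‖_γ`: max of the essential supremum of `‖u‖` over `I` and the supremum of
`‖u‖` over `γ ∩ I`. -/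
def inputNorm {m : ℕ} (γ : Set ℝ) (u : ℝ → Stt m) (I : Set ℝ) : ℝ :=
  max (essSup (fun t => ‖u t‖) (MeasureTheory.volume.restrict I))
      (sSup ((fun t => ‖u t‖) '' (γ ∩ I)))

/-- Solution of the impulsive system `(γ,f,g)` on `[t0,T)` with initial state `x0`
and input `u` (Carathéodory solutions, in integral form, between impulses). -/
structure IsSolution {n m : ℕ} (γ : Set ℝ) (f g : ℝ → Stt n → Stt m → Stt n)
    (t0 : ℝ) (x0 : Stt n) (u : ℝ → Stt m) (T : EReal) (x : ℝ → Stt n) : Prop where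
  lt : (t0 : EReal) < T
  init : x t0 = x0
  flow : ∀ t1 t2 : ℝ, t0 ≤ t1 → t1 ≤ t2 → (t2 : EReal) < T → Set.Ioc t1 t2 ∩ γ = ∅ →
    MeasureTheory.IntegrableOn (fun s => f s (x s) (u s)) (Set.Icc t1 t2) ∧
    x t2 = x t1 + ∫ s in t1..t2, f s (x s) (u s)
  jump : ∀ t ∈ γ, t0 < t → (t : EReal) < T →
    ∃ L : Stt n, Filter.Tendsto x (nhdsWithin t (Set.Iio t)) (nhds L) ∧
      x t = L + g t L (u t)

/-- Maximally defined solution. -/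
def IsMaxSolution {n m : ℕ} (γ : Set ℝ) (f g : ℝ → Stt n → Stt m → Stt n)
    (t0 : ℝ) (x0 : Stt n) (u : ℝ → Stt m) (T : EReal) (x : ℝ → Stt n) : Prop :=
  IsSolution γ f g t0 x0 u T x ∧
    ∀ (T' : EReal) (x' : ℝ → Stt n), IsSolution γ f g t0 x0 u T' x' →
      (∀ t : ℝ, t0 ≤ t → (t : EReal) < T → x' t = x t) → T' ≤ T

/-- Weak `(h⁰,h)`-ISS of a parametrized family of impulsive systems. -/
def WeaklyISS {n m : ℕ} {Λ : Type*} (γ : Λ → Set ℝ)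
    (f g : Λ → ℝ → Stt n → Stt m → Stt n) (h0 h : ℝ → Stt n → ℝ) : Prop :=
  ∃ β : ℝ → ℝ → ℝ, ∃ ρ : ℝ → ℝ, ClassKL β ∧ ClassKInf ρ ∧
    ∀ (l : Λ) (t0 : ℝ) (x0 : Stt n) (u : ℝ → Stt m) (T : EReal) (x : ℝ → Stt n),
      0 ≤ t0 → IsInput u → IsMaxSolution (γ l) (f l) (g l) t0 x0 u T x →
      ∀ t : ℝ, t0 ≤ t → (t : EReal) < T →
        h t (x t) ≤ β (h0 t0 x0) (t - t0) + ρ (inputNorm (γ l) u (Set.Ioc t0 t))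

/-- Strong `(h⁰,h)`-ISS of a parametrized family of impulsive systems. -/
def StronglyISS {n m : ℕ} {Λ : Type*} (γ : Λ → Set ℝ)
    (f g : Λ → ℝ → Stt n → Stt m → Stt n) (h0 h : ℝ → Stt n → ℝ) : Prop :=
  ∃ β : ℝ → ℝ → ℝ, ∃ ρ : ℝ → ℝ, ClassKL β ∧ ClassKInf ρ ∧
    ∀ (l : Λ) (t0 : ℝ) (x0 : Stt n) (u : ℝ → Stt m) (T : EReal) (x : ℝ → Stt n),
      0 ≤ t0 → IsInput u → IsMaxSolution (γ l) (f l) (g l) t0 x0 u T x →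
      ∀ t : ℝ, t0 ≤ t → (t : EReal) < T →
        h t (x t) ≤ β (h0 t0 x0) (t - t0 + (nJumps (γ l) t0 t : ℝ)) +
          ρ (inputNorm (γ l) u (Set.Ioc t0 t))

/-- Locally Lipschitz on a set. -/
def LocLipschitzOn {α β : Type*} [PseudoEMetricSpace α] [PseudoEMetricSpace β]
    (s : Set α) (f : α → β) : Prop :=
  ∀ x ∈ s, ∃ K : NNReal, ∃ t ∈ nhdsWithin x s, LipschitzOnWith K f t

/-- `V ∈ V(γ)` with `Vm` its left-limit function at impulse times: `V` is locally
Lipschitz on each inter-impulse strip and has the joint left limit `Vm τ ξ`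
at each `τ ∈ γ`. -/
def InClassV {n : ℕ} (γ : Set ℝ) (V Vm : ℝ → Stt n → ℝ) : Prop :=
  (∀ a b : ℝ, 0 ≤ a → Set.Ioo a b ∩ γ = ∅ →
    LocLipschitzOn (Set.Ico a b ×ˢ (Set.univ : Set (Stt n)))
      (fun q : ℝ × Stt n => V q.1 q.2)) ∧
  ∀ τ ∈ γ, ∀ ξ : Stt n,
    Filter.Tendsto (fun q : ℝ × Stt n => V q.1 q.2)
      (nhdsWithin (τ, ξ) (Set.Iio τ ×ˢ (Set.univ : Set (Stt n)))) (nhds (Vm τ ξ))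

/-- Upper-right Dini derivative of `V` along the flow map `f`. -/
def DiniAlong {n m : ℕ} (f : ℝ → Stt n → Stt m → Stt n) (V : ℝ → Stt n → ℝ)
    (t : ℝ) (ξ : Stt n) (μ : Stt m) : ℝ :=
  Filter.limsup (fun d : ℝ => (V (t + d) (ξ + d • f t ξ μ) - V t ξ) / d)
    (nhdsWithin 0 (Set.Ioi 0))

/-- Carathéodory function `[0,∞) × [0,∞) → ℝ`. -/
def Caratheodory2 (φ : ℝ → ℝ → ℝ) : Prop :=
  (∀ r : ℝ, Measurable fun t => φ t r) ∧
  (∀ t : ℝ, ContinuousOn (φ t) (Set.Ici 0)) ∧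
  ∀ a b c : ℝ, ∃ mK : ℝ → ℝ, MeasureTheory.IntegrableOn mK (Set.Icc a b) ∧
    ∀ t ∈ Set.Icc a b, ∀ r ∈ Set.Icc (0 : ℝ) c, |φ t r| ≤ mK t

/-- Assumption 1 of the paper, with all the data explicit. -/
def Assumption1 {n m : ℕ} {Λ : Type*} (γ : Λ → Set ℝ)
    (f g : Λ → ℝ → Stt n → Stt m → Stt n) (h0 h : ℝ → Stt n → ℝ)
    (V Vm : Λ → ℝ → Stt n → ℝ) (φ1 φ2 χ π : ℝ → ℝ)
    (vφ al : Λ → ℝ → ℝ → ℝ) : Prop :=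
  ClassKInf φ1 ∧ ClassKInf φ2 ∧ ClassKInf χ ∧ ClassKInf π ∧
  (∀ l : Λ, InClassV (γ l) (V l) (Vm l)) ∧
  (∀ l : Λ, Caratheodory2 (vφ l)) ∧
  (∀ (l : Λ) (t r : ℝ), 0 ≤ t → 0 ≤ r → 0 ≤ al l t r) ∧
  (∀ (l : Λ) (t : ℝ) (ξ : Stt n), 0 ≤ t →
    φ1 (h t ξ) ≤ V l t ξ ∧ V l t ξ ≤ φ2 (h0 t ξ)) ∧
  (∀ (l : Λ) (t : ℝ) (ξ : Stt n) (μ : Stt m), 0 ≤ t → t ∉ γ l → χ ‖μ‖ ≤ V l t ξ →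
    DiniAlong (f l) (V l) t ξ μ ≤ - vφ l t (V l t ξ)) ∧
  (∀ (l : Λ) (t : ℝ) (ξ : Stt n) (μ : Stt m), t ∈ γ l → χ ‖μ‖ ≤ Vm l t ξ →
    V l t (ξ + g l t ξ μ) ≤ al l t (Vm l t ξ)) ∧
  (∀ (l : Λ) (t : ℝ) (ξ : Stt n) (μ : Stt m), t ∈ γ l → Vm l t ξ ≤ χ ‖μ‖ →
    V l t (ξ + g l t ξ μ) ≤ π ‖μ‖)

/-- Solution of the scalar comparison differential/difference inclusion. -/
structure IsCompSol (γ : Set ℝ) (vφ al : ℝ → ℝ → ℝ) (t0 z0 : ℝ) (T : EReal)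
    (z : ℝ → ℝ) : Prop where
  lt : (t0 : EReal) < T
  init : z t0 = z0
  nonneg : ∀ t : ℝ, t0 ≤ t → (t : EReal) < T → 0 ≤ z t
  flow : ∀ t1 t2 : ℝ, t0 ≤ t1 → t1 ≤ t2 → (t2 : EReal) < T → Set.Ioc t1 t2 ∩ γ = ∅ →
    ∃ d : ℝ → ℝ, MeasureTheory.IntegrableOn d (Set.Icc t1 t2) ∧
      (∀ᵐ s ∂MeasureTheory.volume, s ∈ Set.Icc t1 t2 → d s ≤ - vφ s (z s)) ∧
      ∀ t ∈ Set.Icc t1 t2, z t = z t1 + ∫ s in t1..t, d s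
  jump : ∀ t ∈ γ, t0 < t → (t : EReal) < T →
    ∃ L : ℝ, Filter.Tendsto z (nhdsWithin t (Set.Iio t)) (nhds L) ∧ z t ≤ al t L

/-- The family of comparison systems is weakly GUAS. -/
def CompWeakGUAS {Λ : Type*} (γ : Λ → Set ℝ) (vφ al : Λ → ℝ → ℝ → ℝ) : Prop :=
  ∃ β : ℝ → ℝ → ℝ, ClassKL β ∧
    ∀ (l : Λ) (t0 z0 : ℝ) (T : EReal) (z : ℝ → ℝ), 0 ≤ t0 → 0 ≤ z0 →
      IsCompSol (γ l) (vφ l) (al l) t0 z0 T z →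
      ∀ t : ℝ, t0 ≤ t → (t : EReal) < T → z t ≤ β z0 (t - t0)

/-- The family of comparison systems is strongly GUAS. -/
def CompStrongGUAS {Λ : Type*} (γ : Λ → Set ℝ) (vφ al : Λ → ℝ → ℝ → ℝ) : Prop :=
  ∃ β : ℝ → ℝ → ℝ, ClassKL β ∧
    ∀ (l : Λ) (t0 z0 : ℝ) (T : EReal) (z : ℝ → ℝ), 0 ≤ t0 → 0 ≤ z0 →
      IsCompSol (γ l) (vφ l) (al l) t0 z0 T z →
      ∀ t : ℝ, t0 ≤ t → (t : EReal) < T → z t ≤ β z0 (t - t0 + (nJumps (γ l) t0 t : ℝ))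

/-- Nonnegative Carathéodory solution of the scalar ODE `ẇ = rhs(t,w)` on `[t0,T)`. -/
structure IsODESol (rhs : ℝ → ℝ → ℝ) (t0 : ℝ) (T : EReal) (w : ℝ → ℝ) : Prop where
  lt : (t0 : EReal) < T
  nonneg : ∀ t : ℝ, t0 ≤ t → (t : EReal) < T → 0 ≤ w t
  flow : ∀ t1 t2 : ℝ, t0 ≤ t1 → t1 ≤ t2 → (t2 : EReal) < T →
    IntervalIntegrable (fun s => rhs s (w s)) MeasureTheory.volume t1 t2 ∧
    w t2 = w t1 + ∫ s in t1..t2, rhs s (w s)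

/-- Maximally defined forward-in-time solution of `ẇ = rhs(t,w)`. -/
def IsMaxODESol (rhs : ℝ → ℝ → ℝ) (t0 : ℝ) (T : EReal) (w : ℝ → ℝ) : Prop :=
  IsODESol rhs t0 T w ∧
    ∀ (T' : EReal) (w' : ℝ → ℝ), IsODESol rhs t0 T' w' →
      (∀ t : ℝ, t0 ≤ t → (t : EReal) < T → w' t = w t) → T' ≤ T

/-- GUAS of the family of scalar ODEs `ẇ = −φ_λ(t,w)`. -/
def ODEFamilyGUAS {Λ : Type*} (vφ : Λ → ℝ → ℝ → ℝ) : Prop :=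
  ∃ β : ℝ → ℝ → ℝ, ClassKL β ∧
    ∀ (l : Λ) (t0 : ℝ) (T : EReal) (w : ℝ → ℝ), 0 ≤ t0 →
      IsMaxODESol (fun s r => -(vφ l s r)) t0 T w →
      T = (⊤ : EReal) ∧ ∀ t : ℝ, t0 ≤ t → w t ≤ β (w t0) (t - t0)

/-- Solution (on all of `[0,∞)`) of the scalar linear ODE `ẇ = −p(t)·w`. -/
def IsLinSol (p : ℝ → ℝ) (w : ℝ → ℝ) : Prop :=
  ∀ t1 t2 : ℝ, 0 ≤ t1 → t1 ≤ t2 →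
    IntervalIntegrable (fun s => p s * w s) MeasureTheory.volume t1 t2 ∧
    w t2 = w t1 + ∫ s in t1..t2, -(p s * w s)

/-- An impulsive and switching sequence, described through its impulse-time set,
its two switching signals (constant between impulses), and the left limit of the
first switching signal at impulse times. -/
structure SwSignal (Ic Id : Type*) where
  γ : Set ℝ
  σ1 : ℝ → Ic
  σ1m : ℝ → Ic
  σ2 : ℝ → Id
  impulse : IsImpulseSeq γ
  const1 : ∀ a b : ℝ, 0 ≤ a → Set.Ioo a b ∩ γ = ∅ → ∀ t ∈ Set.Ico a b, σ1 t = σ1 a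
  const2 : ∀ a b : ℝ, 0 ≤ a → Set.Ioo a b ∩ γ = ∅ → ∀ t ∈ Set.Ico a b, σ2 t = σ2 a
  leftlim : ∀ t ∈ γ, ∀ᶠ s in nhdsWithin t (Set.Iio t), σ1 s = σ1m t

/-- `σ ∈ SW(J)`. -/
def InSW {Ic Id : Type*} (σ : SwSignal Ic Id) (J : Set (Ic × Ic × Id)) : Prop :=
  ∀ t ∈ σ.γ, (σ.σ1m t, σ.σ1 t, σ.σ2 t) ∈ J

/-- Flow map of the switched impulsive system `Σ_σ`. -/
def swF {n m : ℕ} {Ic Id : Type*} (F : Ic → ℝ → Stt n → Stt m → Stt n)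
    (σ : SwSignal Ic Id) : ℝ → Stt n → Stt m → Stt n :=
  fun t ξ μ => F (σ.σ1 t) t ξ μ

/-- Jump map of the switched impulsive system `Σ_σ`. -/
def swG {n m : ℕ} {Ic Id : Type*} (G : Id → ℝ → Stt n → Stt m → Stt n)
    (σ : SwSignal Ic Id) : ℝ → Stt n → Stt m → Stt n :=
  fun t ξ μ => G (σ.σ2 t) t ξ μ

/-- Weak `(h⁰,h)`-ISS of the family `{Σ_σ}_{σ ∈ SW}`. -/
def SwWeaklyISS {n m : ℕ} {Ic Id : Type*} (F : Ic → ℝ → Stt n → Stt m → Stt n)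
    (G : Id → ℝ → Stt n → Stt m → Stt n) (SW : Set (SwSignal Ic Id))
    (h0 h : ℝ → Stt n → ℝ) : Prop :=
  ∃ β : ℝ → ℝ → ℝ, ∃ ρ : ℝ → ℝ, ClassKL β ∧ ClassKInf ρ ∧
    ∀ σ ∈ SW, ∀ (t0 : ℝ) (x0 : Stt n) (u : ℝ → Stt m) (T : EReal) (x : ℝ → Stt n),
      0 ≤ t0 → IsInput u → IsMaxSolution σ.γ (swF F σ) (swG G σ) t0 x0 u T x →
      ∀ t : ℝ, t0 ≤ t → (t : EReal) < T →
        h t (x t) ≤ β (h0 t0 x0) (t - t0) + ρ (inputNorm σ.γ u (Set.Ioc t0 t))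

/-- Strong `(h⁰,h)`-ISS of the family `{Σ_σ}_{σ ∈ SW}`. -/
def SwStronglyISS {n m : ℕ} {Ic Id : Type*} (F : Ic → ℝ → Stt n → Stt m → Stt n)
    (G : Id → ℝ → Stt n → Stt m → Stt n) (SW : Set (SwSignal Ic Id))
    (h0 h : ℝ → Stt n → ℝ) : Prop :=
  ∃ β : ℝ → ℝ → ℝ, ∃ ρ : ℝ → ℝ, ClassKL β ∧ ClassKInf ρ ∧
    ∀ σ ∈ SW, ∀ (t0 : ℝ) (x0 : Stt n) (u : ℝ → Stt m) (T : EReal) (x : ℝ → Stt n),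
      0 ≤ t0 → IsInput u → IsMaxSolution σ.γ (swF F σ) (swG G σ) t0 x0 u T x →
      ∀ t : ℝ, t0 ≤ t → (t : EReal) < T →
        h t (x t) ≤ β (h0 t0 x0) (t - t0 + (nJumps σ.γ t0 t : ℝ)) +
          ρ (inputNorm σ.γ u (Set.Ioc t0 t))

/-- Total activation time in `(t0,t]` of the flow modes in `A`. -/
def actT {Ic Id : Type*} (σ : SwSignal Ic Id) (A : Set Ic) (t0 t : ℝ) : ℝ :=
  (MeasureTheory.volume {r : ℝ | r ∈ Set.Ioc t0 t ∧ σ.σ1 r ∈ A}).toReal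

/-- Number of impulse times in `(t0,t]` whose mode combination lies in `Jp`. -/
def nJumpsIn {Ic Id : Type*} (σ : SwSignal Ic Id) (Jp : Set (Ic × Ic × Id))
    (t0 t : ℝ) : ℕ :=
  (σ.γ ∩ Set.Ioc t0 t ∩ {r : ℝ | (σ.σ1m r, σ.σ1 r, σ.σ2 r) ∈ Jp}).ncard

/-- Assumption 2 of the paper (for switched impulsive systems), data explicit. -/
def Assumption2 {n m : ℕ} {Ic Id : Type*}
    (F : Ic → ℝ → Stt n → Stt m → Stt n) (G : Id → ℝ → Stt n → Stt m → Stt n)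
    (h0 h : ℝ → Stt n → ℝ) (J : Set (Ic × Ic × Id))
    (v : Ic → ℝ → Stt n → ℝ) (φ1 φ2 χ π : ℝ → ℝ)
    (vφ : Ic → ℝ → ℝ → ℝ) (al : Ic × Ic × Id → ℝ → ℝ → ℝ) : Prop :=
  ClassKInf φ1 ∧ ClassKInf φ2 ∧ ClassKInf χ ∧ ClassKInf π ∧
  (∀ i : Ic, LocLipschitzOn ((Set.Ici (0 : ℝ)) ×ˢ (Set.univ : Set (Stt n)))
      (fun q : ℝ × Stt n => v i q.1 q.2)) ∧
  (∀ i : Ic, Caratheodory2 (vφ i)) ∧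
  (∀ e ∈ J, ∀ t r : ℝ, 0 ≤ t → 0 ≤ r → 0 ≤ al e t r) ∧
  (∀ (i : Ic) (t : ℝ) (ξ : Stt n), 0 ≤ t →
    φ1 (h t ξ) ≤ v i t ξ ∧ v i t ξ ≤ φ2 (h0 t ξ)) ∧
  (∀ (i : Ic) (t : ℝ) (ξ : Stt n) (μ : Stt m), 0 ≤ t → χ ‖μ‖ ≤ v i t ξ →
    DiniAlong (F i) (v i) t ξ μ ≤ - vφ i t (v i t ξ)) ∧
  (∀ (ι i : Ic) (j : Id), (ι, i, j) ∈ J → ∀ (t : ℝ) (ξ : Stt n) (μ : Stt m),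
    0 ≤ t → χ ‖μ‖ ≤ v ι t ξ → v i t (ξ + G j t ξ μ) ≤ al (ι, i, j) t (v ι t ξ)) ∧
  (∀ (ι i : Ic) (j : Id), (ι, i, j) ∈ J → ∀ (t : ℝ) (ξ : Stt n) (μ : Stt m),
    0 ≤ t → v ι t ξ ≤ χ ‖μ‖ → v i t (ξ + G j t ξ μ) ≤ π ‖μ‖)

namespace AbsolutelyContinuousOnInterval

theorem comp_locallyLipschitzOn {X Y : Type*} [SeminormedAddCommGroup X] [PseudoMetricSpace Y]
    {F : X → Y} {g : ℝ → X} {a b : ℝ} (hg : AbsolutelyContinuousOnInterval g a b)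
    (hF : LocallyLipschitzOn (g '' uIcc a b) F) :
    AbsolutelyContinuousOnInterval (fun t => F (g t)) a b := by
  obtain ⟨K, hK⟩ := hF.exists_lipschitzOnWith_of_compact
    (isCompact_uIcc.image_of_continuousOn hg.continuousOn)
  unfold AbsolutelyContinuousOnInterval at hg ⊢
  refine squeeze_zero' (.of_forall fun _ => Finset.sum_nonneg fun _ _ => dist_nonneg) ?_
    (by simpa using hg.const_mul (K : ℝ))
  rw [eventually_inf_principal]
  filter_upwards with E hE
  rw [Finset.mul_sum]
  exact Finset.sum_le_sum fun i hi => hK.dist_le_mul _ (mem_image_of_mem _ (hE.1 i hi).1) _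
    (mem_image_of_mem _ (hE.1 i hi).2)

theorem prodMk {X Y : Type*} [PseudoMetricSpace X] [PseudoMetricSpace Y]
    {f : ℝ → X} {g : ℝ → Y} {a b : ℝ} (hf : AbsolutelyContinuousOnInterval f a b)
    (hg : AbsolutelyContinuousOnInterval g a b) :
    AbsolutelyContinuousOnInterval (fun t => (f t, g t)) a b := by
  unfold AbsolutelyContinuousOnInterval at hf hg ⊢
  refine squeeze_zero (fun _ => Finset.sum_nonneg fun _ _ => dist_nonneg) (fun E => ?_)
    (by simpa using hf.add hg)
  rw [← Finset.sum_add_distrib]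
  refine Finset.sum_le_sum fun i _ => ?_
  rw [Prod.dist_eq]
  exact max_le_add_of_nonneg dist_nonneg dist_nonneg

theorem congr {X : Type*} [PseudoMetricSpace X] {f g : ℝ → X} {a b : ℝ}
    (hf : AbsolutelyContinuousOnInterval f a b) (hfg : EqOn f g (uIcc a b)) :
    AbsolutelyContinuousOnInterval g a b := by
  refine Tendsto.congr' ?_ hf
  filter_upwards [mem_inf_of_right (mem_principal_self _)] with E hE
  exact Finset.sum_congr rfl fun i hi => by rw [hfg (hE.1 i hi).1, hfg (hE.1 i hi).2]

theorem const {X : Type*} [PseudoMetricSpace X] (c : X) (a b : ℝ) :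
    AbsolutelyContinuousOnInterval (fun _ => c) a b :=
  ((LipschitzWith.const c : LipschitzWith 0 _).lipschitzOnWith).absolutelyContinuousOnInterval

theorem id (a b : ℝ) : AbsolutelyContinuousOnInterval (fun s : ℝ => s) a b :=
  ((LipschitzWith.id : LipschitzWith 1 _).lipschitzOnWith).absolutelyContinuousOnInterval

theorem of_dist_le {X Y : Type*} [PseudoMetricSpace X] [PseudoMetricSpace Y] {f : ℝ → X}
    {g : ℝ → Y} {a b : ℝ} (hg : AbsolutelyContinuousOnInterval g a b)
    (h : ∀ s ∈ uIcc a b, ∀ r ∈ uIcc a b, dist (f s) (f r) ≤ dist (g s) (g r)) :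
    AbsolutelyContinuousOnInterval f a b := by
  unfold AbsolutelyContinuousOnInterval at hg ⊢
  refine squeeze_zero' (.of_forall fun _ => Finset.sum_nonneg fun _ _ => dist_nonneg) ?_ hg
  rw [eventually_inf_principal]
  filter_upwards with E hE
  exact Finset.sum_le_sum fun i hi => h _ (hE.1 i hi).1 _ (hE.1 i hi).2

theorem integral {X : Type*} [NormedAddCommGroup X] [NormedSpace ℝ X] {f : ℝ → X} {a b : ℝ}
    (hf : IntervalIntegrable f volume a b) :
    AbsolutelyContinuousOnInterval (fun t => ∫ s in a..t, f s) a b := by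
  refine (hf.norm.absolutelyContinuousOnInterval_intervalIntegral left_mem_uIcc).of_dist_le
    fun s hs r hr => ?_
  have hi : ∀ q ∈ uIcc a b, IntervalIntegrable f volume a q := fun q hq =>
    hf.mono_set (uIcc_subset_uIcc left_mem_uIcc hq)
  rw [dist_eq_norm, Real.dist_eq, intervalIntegral.integral_interval_sub_left (hi s hs) (hi r hr),
    intervalIntegral.integral_interval_sub_left (hi s hs).norm (hi r hr).norm]
  exact intervalIntegral.norm_integral_le_abs_integral_norm

theorem rexp {g : ℝ → ℝ} {a b : ℝ} (hg : AbsolutelyContinuousOnInterval g a b) :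
    AbsolutelyContinuousOnInterval (fun t => Real.exp (g t)) a b :=
  hg.comp_locallyLipschitzOn
    ((Real.contDiff_exp (n := 1)).locallyLipschitz.locallyLipschitzOn)

theorem ae_hasDerivAt_deriv {f : ℝ → ℝ} {a b : ℝ} (hf : AbsolutelyContinuousOnInterval f a b) :
    ∀ᵐ s, s ∈ uIcc a b → HasDerivAt f (deriv f s) s := by
  filter_upwards [hf.boundedVariationOn.ae_differentiableAt_of_mem_uIcc] with s hs hm
  exact (hs hm).hasDerivAt

/-- An absolutely continuous function starting below a level `C` and nonincreasing wherever it
exceeds `C` stays below `C`. -/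
theorem le_of_ae_deriv_nonpos {Y : ℝ → ℝ} {a b C : ℝ} (hab : a ≤ b)
    (hY : AbsolutelyContinuousOnInterval Y a b) (ha : Y a ≤ C)
    (hd : ∀ᵐ s, s ∈ Ioo a b → C < Y s → deriv Y s ≤ 0) : Y b ≤ C := by
  by_contra! hb
  have hcont : ContinuousOn Y (Icc a b) := by simpa [uIcc_of_le hab] using hY.continuousOn
  set S := Icc a b ∩ Y ⁻¹' Iic C
  have hS : IsCompact S :=
    isCompact_Icc.of_isClosed_subset (hcont.preimage_isClosed_of_isClosed isClosed_Icc isClosed_Iic)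
      inter_subset_left
  obtain ⟨r, ⟨⟨har, hrb⟩, hrC⟩, hmax⟩ := hS.exists_isGreatest ⟨a, ⟨le_rfl, hab⟩, ha⟩
  have hrC : Y r ≤ C := hrC
  have habove : ∀ s ∈ Ioo r b, C < Y s := fun s hs => by
    by_contra! h
    exact absurd (hmax ⟨⟨har.trans hs.1.le, hs.2.le⟩, h⟩) (not_le.2 hs.1)
  have hint : ∫ s in r..b, deriv Y s ≤ 0 := by
    rw [intervalIntegral.integral_of_le hrb, integral_Ioc_eq_integral_Ioo]
    refine integral_nonpos_of_ae ((ae_restrict_iff' measurableSet_Ioo).2 ?_)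
    filter_upwards [hd] with s hs hm
    exact hs ⟨har.trans_lt hm.1, hm.2⟩ (habove s hm)
  have hsub : uIcc r b ⊆ uIcc a b := by
    rw [uIcc_of_le hrb, uIcc_of_le hab]; exact Icc_subset_Icc_left har
  have := (hY.mono hsub).integral_deriv_eq_sub
  linarith

end AbsolutelyContinuousOnInterval

namespace LocIntegrable

variable {p : ℝ → ℝ}

theorem locallyIntegrable (hp : LocIntegrable p) : LocallyIntegrable p := by
  refine locallyIntegrable_iff.2 fun K hK => ?_
  obtain ⟨R, hR⟩ := hK.isBounded.subset_closedBall 0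
  exact (hp (0 - R) (0 + R)).mono_set (by rwa [Real.closedBall_eq_Icc] at hR)

theorem intervalIntegrable (hp : LocIntegrable p) (a b : ℝ) :
    IntervalIntegrable p volume a b :=
  intervalIntegrable_iff.2
    ((hp.locallyIntegrable.integrableOn_isCompact isCompact_uIcc).mono_set uIoc_subset_uIcc)

theorem absolutelyContinuousOnInterval_integral (hp : LocIntegrable p) (a b : ℝ) :
    AbsolutelyContinuousOnInterval (fun t => ∫ s in (0 : ℝ)..t, p s) a b := by
  have hle : min 0 (min a b) ≤ max 0 (max a b) := (min_le_left _ _).trans (le_max_left _ _)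
  refine ((hp.intervalIntegrable (min 0 (min a b))
    (max 0 (max a b))).absolutelyContinuousOnInterval_intervalIntegral (c := 0) ?_).mono ?_
  · simp
  · rw [uIcc_of_le hle]
    exact Icc_subset_Icc (min_le_right _ _) (le_max_right _ _)

theorem isLinSol_exp (hp : LocIntegrable p) :
    IsLinSol p (fun t => Real.exp (-∫ s in (0 : ℝ)..t, p s)) := by
  intro t1 t2 _ _
  have hac := (hp.absolutelyContinuousOnInterval_integral t1 t2).fun_neg.rexp
  refine ⟨(hp.intervalIntegrable t1 t2).mul_continuousOn hac.continuousOn, ?_⟩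
  have hderiv : ∫ s in t1..t2, deriv (fun t => Real.exp (-∫ s in (0 : ℝ)..t, p s)) s =
      ∫ s in t1..t2, -(p s * Real.exp (-∫ s in (0 : ℝ)..s, p s)) := by
    refine intervalIntegral.integral_congr_ae ?_
    filter_upwards [LocallyIntegrable.ae_hasDerivAt_integral hp.locallyIntegrable] with s hs _
    rw [(hs 0).fun_neg.exp.deriv]
    ring
  have := hac.integral_deriv_eq_sub
  rw [← hderiv, this]
  ring

end LocIntegrable

theorem HasDerivAt.le_of_limsup_dini_le {n : ℕ} {V : ℝ → Stt n → ℝ} {x : ℝ → Stt n} {v : Stt n}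
    {a b s w B : ℝ} (hs : s ∈ Ico a b)
    (hV : LocLipschitzOn (Ico a b ×ˢ (univ : Set (Stt n))) (fun q : ℝ × Stt n => V q.1 q.2))
    (hx : HasDerivAt x v s) (hw : HasDerivAt (fun r => V r (x r)) w s)
    (hB : limsup (fun d : ℝ => (V (s + d) (x s + d • v) - V s (x s)) / d)
      (nhdsWithin 0 (Ioi 0)) ≤ B) : w ≤ B := by
  obtain ⟨K, N, hN, hK⟩ := hV (s, x s) ⟨hs, mem_univ _⟩
  have hmem : ∀ᶠ e : ℝ in nhdsWithin 0 (Ioi 0), s + e ∈ Ico a b := by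
    have : ∀ᶠ e : ℝ in nhdsWithin 0 (Ioi 0), e ∈ Ioo 0 (b - s) :=
      Ioo_mem_nhdsGT (sub_pos.2 hs.2)
    filter_upwards [this] with e he
    exact ⟨by linarith [he.1, hs.1], by linarith [he.2]⟩
  have hN' : ∀ y : ℝ → Stt n, Tendsto y (nhdsWithin 0 (Ioi 0)) (nhds (x s)) →
      ∀ᶠ e : ℝ in nhdsWithin 0 (Ioi 0), (s + e, y e) ∈ N := fun y hy => by
    refine Tendsto.eventually (tendsto_nhdsWithin_iff.2 ⟨Tendsto.prodMk_nhds ?_ hy, ?_⟩) hN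
    · exact ((continuous_const.add continuous_id).tendsto' 0 s (by simp)).mono_left
        nhdsWithin_le_nhds
    · filter_upwards [hmem] with e he using ⟨he, mem_univ _⟩
  have hx0 : Tendsto (fun e => x (s + e)) (nhdsWithin 0 (Ioi 0)) (nhds (x s)) := by
    refine (hx.continuousAt.tendsto.comp
      ((continuous_const.add continuous_id).tendsto' 0 s (by simp))).mono_left nhdsWithin_le_nhds
  have hv0 : Tendsto (fun e : ℝ => x s + e • v) (nhdsWithin 0 (Ioi 0)) (nhds (x s)) :=
    (Continuous.tendsto' (by fun_prop) 0 _ (by simp)).mono_left nhdsWithin_le_nhds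
  have hslope := (hasDerivAt_iff_tendsto_slope_zero.1 hw).mono_left
    (nhdsWithin_mono (0 : ℝ) (s := Ioi 0) fun e he => (mem_Ioi.1 he).ne')
  have hxslope := (hasDerivAt_iff_tendsto_slope_zero.1 hx).mono_left
    (nhdsWithin_mono (0 : ℝ) (s := Ioi 0) fun e he => (mem_Ioi.1 he).ne')
  have herr : Tendsto (fun e : ℝ => (V (s + e) (x s + e • v) - V (s + e) (x (s + e))) / e)
      (nhdsWithin 0 (Ioi 0)) (nhds 0) := by
    have hlim : Tendsto (fun e : ℝ => K * ‖e⁻¹ • (x (s + e) - x s) - v‖)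
        (nhdsWithin 0 (Ioi 0)) (nhds 0) := by
      simpa using (hxslope.sub_const v).norm.const_mul (K : ℝ)
    refine squeeze_zero_norm' ?_ hlim
    filter_upwards [hN' _ hx0, hN' _ hv0, self_mem_nhdsWithin] with e h1 h2 (he : 0 < e)
    have h3 := hK.dist_le_mul _ h2 _ h1
    rw [Prod.dist_eq, dist_self, max_eq_right dist_nonneg, dist_eq_norm, dist_eq_norm] at h3
    have h4 : e⁻¹ • (x (s + e) - x s) - v = -(e⁻¹ • (x s + e • v - x (s + e))) := by
      rw [smul_sub, smul_sub, smul_add, smul_smul, inv_mul_cancel₀ he.ne', one_smul]; abel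
    rw [h4, norm_neg, norm_smul, norm_div, norm_inv, Real.norm_of_nonneg he.le, div_le_iff₀ he]
    calc _ ≤ _ := h3
      _ = _ := by field_simp
  have htot : Tendsto (fun e : ℝ => (V (s + e) (x s + e • v) - V s (x s)) / e)
      (nhdsWithin 0 (Ioi 0)) (nhds w) := by
    refine (by simpa using hslope.add herr : Tendsto _ _ (nhds w)).congr fun e => ?_
    ring
  rwa [htot.limsup_eq] at hB

namespace IsImpulseSeq

variable {γ : Set ℝ}

theorem finite_inter_Ioc (hγ : IsImpulseSeq γ) (s t : ℝ) : (γ ∩ Ioc s t).Finite :=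
  (hγ.2 t).subset (inter_subset_inter_right _ Ioc_subset_Iic_self)

theorem nJumps_add (hγ : IsImpulseSeq γ) {s r t : ℝ} (hsr : s ≤ r) (hrt : r ≤ t) :
    nJumps γ s r + nJumps γ r t = nJumps γ s t := by
  unfold nJumps
  rw [← ncard_union_eq _ (hγ.finite_inter_Ioc s r) (hγ.finite_inter_Ioc r t),
    ← inter_union_distrib_left, Ioc_union_Ioc_eq_Ioc hsr hrt]
  exact (Ioc_disjoint_Ioc_of_le le_rfl).mono inter_subset_right inter_subset_right

theorem nJumps_succ_le (hγ : IsImpulseSeq γ) {s r t : ℝ} (hsr : s ≤ r) (hrt : r < t)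
    (ht : t ∈ γ) : nJumps γ s r + 1 ≤ nJumps γ s t := by
  rw [← hγ.nJumps_add hsr hrt.le]
  have : 0 < nJumps γ r t :=
    (ncard_pos (hγ.finite_inter_Ioc r t)).2 ⟨t, ht, hrt, le_rfl⟩
  omega

theorem exists_gt_Ioo_inter_eq_empty (hγ : IsImpulseSeq γ) {a b : ℝ} (hno : Ioc a b ∩ γ = ∅) :
    ∃ b' > b, Ioo a b' ∩ γ = ∅ := by
  have hU : (γ ∩ Ioc b (b + 1))ᶜ ∩ Iio (b + 1) ∈ nhds b :=
    inter_mem ((hγ.finite_inter_Ioc b (b + 1)).isClosed.isOpen_compl.mem_nhds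
      fun h => lt_irrefl _ h.2.1) (Iio_mem_nhds (by linarith))
  obtain ⟨b', hb', hsub⟩ := exists_Ico_subset_of_mem_nhds hU (exists_gt b)
  refine ⟨b', hb', eq_empty_of_forall_notMem fun s hs => ?_⟩
  rcases le_or_gt s b with h | h
  · exact notMem_empty s (hno ▸ ⟨⟨hs.1.1, h⟩, hs.2⟩)
  · have := hsub ⟨h.le, hs.1.2⟩
    exact this.1 ⟨hs.2, h, this.2.le⟩

end IsImpulseSeq

theorem nJumps_self (γ : Set ℝ) (t : ℝ) : nJumps γ t t = 0 := by simp [nJumps]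

section InputNorm

variable {m : ℕ} {γ : Set ℝ} {u : ℝ → Stt m}

theorem inputNorm_nonneg (I : Set ℝ) : 0 ≤ inputNorm γ u I :=
  le_max_of_le_right (Real.sSup_nonneg (by rintro _ ⟨s, _, rfl⟩; exact norm_nonneg _))

theorem IsInput.ae_norm_le_inputNorm (hu : IsInput u) {t0 t : ℝ} (ht0 : 0 ≤ t0) :
    ∀ᵐ s, s ∈ Ioc t0 t → ‖u s‖ ≤ inputNorm γ u (Ioc t0 t) := by
  obtain ⟨C, hC⟩ := hu.2 t
  have hbd : IsBoundedUnder (· ≤ ·) (ae (volume.restrict (Ioc t0 t))) fun s => ‖u s‖ := by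
    refine ⟨C, eventually_map.2 ((ae_restrict_iff' measurableSet_Ioc).2 ?_)⟩
    filter_upwards [hC] with s hs hm using hs ⟨ht0.trans hm.1.le, hm.2⟩
  filter_upwards [(ae_restrict_iff' measurableSet_Ioc).1 (ae_le_essSup hbd)] with s hs hm
  exact (hs hm).trans (le_max_left _ _)

theorem IsImpulseSeq.norm_le_inputNorm (hγ : IsImpulseSeq γ) {t0 t s : ℝ}
    (hs : s ∈ γ) (hst : s ∈ Ioc t0 t) : ‖u s‖ ≤ inputNorm γ u (Ioc t0 t) :=
  (le_csSup ((hγ.finite_inter_Ioc t0 t).image fun s => ‖u s‖).bddAbove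
    (mem_image_of_mem (fun s => ‖u s‖) ⟨hs, hst⟩)).trans
    (le_max_right _ _)

end InputNorm

namespace ClassKInf

variable {φ ψ : ℝ → ℝ}

theorem nonneg (h : ClassKInf φ) {r : ℝ} (hr : 0 ≤ r) : 0 ≤ φ r := by
  simpa [h.2.2.1] using h.2.1.monotoneOn (mem_Ici.2 le_rfl) (mem_Ici.2 hr) hr

theorem mono (h : ClassKInf φ) {r s : ℝ} (hr : 0 ≤ r) (hrs : r ≤ s) : φ r ≤ φ s :=
  h.2.1.monotoneOn (mem_Ici.2 hr) (mem_Ici.2 (hr.trans hrs)) hrs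

theorem comp (h : ClassKInf φ) (h' : ClassKInf ψ) : ClassKInf fun r => φ (ψ r) := by
  refine ⟨h.1.comp h'.1 fun r hr => h'.nonneg hr, fun r hr s hs hrs =>
    h.2.1 (h'.nonneg hr) (h'.nonneg hs) (h'.2.1 hr hs hrs), by simp [h.2.2.1, h'.2.2.1],
    fun M => ?_⟩
  obtain ⟨r, hr, hM⟩ := h.2.2.2 M
  obtain ⟨s, hs, hrs⟩ := h'.2.2.2 r
  exact ⟨s, hs, hM.trans (h.mono hr hrs)⟩

theorem const_mul (h : ClassKInf φ) {A : ℝ} (hA : 0 < A) : ClassKInf fun r => A * φ r := by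
  refine ⟨h.1.const_smul A, fun r hr s hs hrs => mul_lt_mul_of_pos_left (h.2.1 hr hs hrs) hA,
    by simp [h.2.2.1], fun M => ?_⟩
  obtain ⟨r, hr, hM⟩ := h.2.2.2 (M / A)
  exact ⟨r, hr, by rwa [div_le_iff₀' hA] at hM⟩

theorem add (h : ClassKInf φ) (h' : ClassKInf ψ) : ClassKInf fun r => φ r + ψ r := by
  refine ⟨h.1.add h'.1, fun r hr s hs hrs => add_lt_add (h.2.1 hr hs hrs) (h'.2.1 hr hs hrs),
    by simp [h.2.2.1, h'.2.2.1], fun M => ?_⟩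
  obtain ⟨r, hr, hM⟩ := h.2.2.2 M
  exact ⟨r, hr, by linarith [h'.nonneg hr]⟩

/-- Class `K∞` functions have class `K∞` left inverses. -/
theorem exists_leftInverse (h : ClassKInf φ) :
    ∃ ψ, ClassKInf ψ ∧ ∀ r, 0 ≤ r → ψ (φ r) = r := by
  set Φ : ℝ → ℝ := fun r => if 0 ≤ r then φ r else r with hΦ
  have hpos : ∀ {r}, 0 ≤ r → Φ r = φ r := fun hr => if_pos hr
  have hneg : ∀ {r}, r < 0 → Φ r = r := fun hr => if_neg (not_le.2 hr)
  have hmono : StrictMono Φ := fun r s hrs => by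
    rcases lt_or_ge r 0 with hr | hr
    · rcases lt_or_ge s 0 with hs | hs
      · rwa [hneg hr, hneg hs]
      · rw [hneg hr, hpos hs]; exact hr.trans_le (h.nonneg hs)
    · rw [hpos hr, hpos (hr.trans hrs.le)]; exact h.2.1 hr (hr.trans hrs.le) hrs
  have hsurj : Function.Surjective Φ := fun y => by
    rcases lt_or_ge y 0 with hy | hy
    · exact ⟨y, hneg hy⟩
    · obtain ⟨r, hr, hyr⟩ := h.2.2.2 y
      obtain ⟨s, hs, hsy⟩ := intermediate_value_Icc hr (h.1.mono Icc_subset_Ici_self)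
        ⟨by rwa [h.2.2.1], hyr⟩
      exact ⟨s, (hpos hs.1).trans hsy⟩
  set e := hmono.orderIsoOfSurjective Φ hsurj
  have he : ∀ r, 0 ≤ r → e.symm (φ r) = r := fun r hr => by
    rw [← hpos hr]; exact e.symm_apply_apply r
  refine ⟨e.symm, ⟨e.symm.continuous.continuousOn, e.symm.strictMono.strictMonoOn _, ?_,
    fun M => ⟨φ (max M 0), h.nonneg (le_max_right _ _), ?_⟩⟩, he⟩
  · simpa [h.2.2.1] using he 0 le_rfl
  · rw [he _ (le_max_right _ _)]; exact le_max_left _ _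

theorem classKL_exp_decay (hψ : ClassKInf ψ) (hφ : ClassKInf φ) {A η : ℝ} (hA : 0 < A)
    (hη : 0 < η) : ClassKL fun r s => ψ (A * Real.exp (-(η * s)) * φ r) := by
  refine ⟨fun s _ => hψ.comp (hφ.const_mul (by positivity)), fun r hr => ⟨?_, ?_⟩⟩
  · intro s _ s' _ hss'
    have := hφ.nonneg hr
    refine hψ.mono (by positivity) ?_
    gcongr
  · have h0 : Tendsto ψ (nhdsWithin 0 (Ici 0)) (nhds 0) := by
      simpa [ContinuousWithinAt, hψ.2.2.1] using hψ.1 0 (mem_Ici.2 le_rfl)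
    refine h0.comp (tendsto_nhdsWithin_iff.2 ⟨?_, .of_forall fun s => ?_⟩)
    · have : Tendsto (fun s => Real.exp (-(η * s))) atTop (nhds 0) :=
        Real.tendsto_exp_neg_atTop_nhds_zero.comp (tendsto_id.const_mul_atTop hη)
      simpa using (this.const_mul A).mul_const (φ r)
    · have := hφ.nonneg hr
      exact mem_Ici.2 (by positivity)

end ClassKInf

section Lyapunov

variable {n m : ℕ} {γ : Set ℝ} {f g : ℝ → Stt n → Stt m → Stt n} {V Vm : ℝ → Stt n → ℝ}
  {p χ π : ℝ → ℝ} {x : ℝ → Stt n} {u : ℝ → Stt m}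

/-- Between impulses, a level dominating both the initial weighted value of `V` and the weighted
input threshold is never exceeded by the weighted value of `V`. -/
theorem absolutelyContinuousOnInterval_of_eq_integral {X : Type*} [NormedAddCommGroup X]
    [NormedSpace ℝ X] {F y : ℝ → X} {a b : ℝ} (hab : a ≤ b) (hF : IntervalIntegrable F volume a b)
    (hy : ∀ s ∈ Icc a b, y s = y a + ∫ r in a..s, F r) :
    AbsolutelyContinuousOnInterval y a b := by
  refine ((AbsolutelyContinuousOnInterval.const (y a) a b).fun_add
    (AbsolutelyContinuousOnInterval.integral hF)).congr fun s hs => ?_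
  rw [uIcc_of_le hab] at hs
  exact (hy s hs).symm

theorem LocLipschitzOn.absolutelyContinuousOnInterval_comp {n : ℕ} {V : ℝ → Stt n → ℝ}
    {y : ℝ → Stt n} {a b c : ℝ} (hab : a ≤ b) (hbc : b < c)
    (hV : LocLipschitzOn (Ico a c ×ˢ (univ : Set (Stt n))) (fun q : ℝ × Stt n => V q.1 q.2))
    (hy : AbsolutelyContinuousOnInterval y a b) :
    AbsolutelyContinuousOnInterval (fun s => V s (y s)) a b := by
  have hsub : (fun s => (s, y s)) '' uIcc a b ⊆ Ico a c ×ˢ (univ : Set (Stt n)) := by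
    rintro _ ⟨s, hs, rfl⟩
    rw [uIcc_of_le hab] at hs
    exact ⟨⟨hs.1, hs.2.trans_lt hbc⟩, mem_univ _⟩
  exact ((AbsolutelyContinuousOnInterval.id a b).prodMk hy).comp_locallyLipschitzOn
    (F := fun q : ℝ × Stt n => V q.1 q.2) (LocallyLipschitzOn.mono (fun q hq => hV q hq) hsub)

theorem flow_weighted_le (hγ : IsImpulseSeq γ) (hp : LocIntegrable p)
    (hV : ∀ a b : ℝ, 0 ≤ a → Ioo a b ∩ γ = ∅ →
      LocLipschitzOn (Ico a b ×ˢ (univ : Set (Stt n))) (fun q : ℝ × Stt n => V q.1 q.2))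
    (hdini : ∀ (t : ℝ) (ξ : Stt n) (μ : Stt m), 0 ≤ t → t ∉ γ → χ ‖μ‖ ≤ V t ξ →
      DiniAlong f V t ξ μ ≤ -(p t * V t ξ))
    {a b : ℝ} (ha : 0 ≤ a) (hab : a ≤ b) (hno : Ioc a b ∩ γ = ∅)
    (hint : IntegrableOn (fun s => f s (x s) (u s)) (Icc a b))
    (hx : ∀ s ∈ Icc a b, x s = x a + ∫ r in a..s, f r (x r) (u r))
    {M C : ℝ} (hM : ∀ᵐ s, s ∈ Ioc a b → χ ‖u s‖ ≤ M)
    (hC : V a (x a) * Real.exp (∫ r in (0 : ℝ)..a, p r) ≤ C)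
    (hMC : ∀ s ∈ Icc a b, M * Real.exp (∫ r in (0 : ℝ)..s, p r) ≤ C) :
    V b (x b) * Real.exp (∫ r in (0 : ℝ)..b, p r) ≤ C := by
  obtain ⟨b', hbb', hno'⟩ := hγ.exists_gt_Ioo_inter_eq_empty hno
  have hVab := hV a b' ha hno'
  have hint' : IntervalIntegrable (fun s => f s (x s) (u s)) volume a b :=
    (intervalIntegrable_iff_integrableOn_Icc_of_le hab).2 hint
  have hWac := hVab.absolutelyContinuousOnInterval_comp hab hbb'
    (absolutelyContinuousOnInterval_of_eq_integral hab hint' hx)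
  have hEac := (hp.absolutelyContinuousOnInterval_integral a b).rexp
  have hYac : AbsolutelyContinuousOnInterval
      (fun s => V s (x s) * Real.exp (∫ r in (0 : ℝ)..s, p r)) a b := hWac.fun_mul hEac
  refine AbsolutelyContinuousOnInterval.le_of_ae_deriv_nonpos
    (Y := fun s => V s (x s) * Real.exp (∫ r in (0 : ℝ)..s, p r)) hab hYac hC ?_
  filter_upwards [hWac.ae_hasDerivAt_deriv, hint'.ae_hasDerivAt_integral,
    LocallyIntegrable.ae_hasDerivAt_integral hp.locallyIntegrable, hM] with s hWs hxs hps hMs hs hCs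
  have hsI : s ∈ Icc a b := Ioo_subset_Icc_self hs
  have hsu : s ∈ uIcc a b := by rwa [uIcc_of_le hab]
  have hxd : HasDerivAt x (f s (x s) (u s)) s := by
    refine ((hxs hsu a left_mem_uIcc).const_add (x a)).congr_of_eventuallyEq ?_
    filter_upwards [Icc_mem_nhds hs.1 hs.2] with r hr using hx r hr
  have hE : 0 < Real.exp (∫ r in (0 : ℝ)..s, p r) := Real.exp_pos _
  have hMV : M < V s (x s) := lt_of_mul_lt_mul_right ((hMC s hsI).trans_lt hCs) hE.le
  have hsγ : s ∉ γ := fun h => notMem_empty s (hno ▸ ⟨⟨hs.1, hs.2.le⟩, h⟩)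
  have hle := HasDerivAt.le_of_limsup_dini_le ⟨hs.1.le, hs.2.trans hbb'⟩ hVab hxd (hWs hsu)
    (hdini s (x s) (u s) (ha.trans hs.1.le) hsγ ((hMs ⟨hs.1, hs.2.le⟩).trans hMV.le))
  rw [((hWs hsu).fun_mul (hps 0).exp).deriv]
  nlinarith

theorem IsSolution.weighted_le (hγ : IsImpulseSeq γ) (hp : LocIntegrable p)
    (hV : InClassV γ V Vm) (hV0 : ∀ (t : ℝ) (ξ : Stt n), 0 ≤ t → 0 ≤ V t ξ)
    (hdini : ∀ (t : ℝ) (ξ : Stt n) (μ : Stt m), 0 ≤ t → t ∉ γ → χ ‖μ‖ ≤ V t ξ →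
      DiniAlong f V t ξ μ ≤ -(p t * V t ξ))
    {d D : ℝ} (hdD : d ≤ D) (hD : 1 ≤ D)
    (hjump : ∀ (t : ℝ) (ξ : Stt n) (μ : Stt m), t ∈ γ → χ ‖μ‖ ≤ Vm t ξ →
      V t (ξ + g t ξ μ) ≤ d * Vm t ξ)
    (hjump' : ∀ (t : ℝ) (ξ : Stt n) (μ : Stt m), t ∈ γ → Vm t ξ ≤ χ ‖μ‖ →
      V t (ξ + g t ξ μ) ≤ π ‖μ‖)
    {t0 t : ℝ} {x0 : Stt n} {T : EReal} (ht0 : 0 ≤ t0)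
    (hx : IsSolution γ f g t0 x0 u T x) (htT : (t : EReal) < T) {M C : ℝ}
    (hχM : ∀ᵐ s, s ∈ Ioc t0 t → χ ‖u s‖ ≤ M) (hπM : ∀ s ∈ γ, s ∈ Ioc t0 t → π ‖u s‖ ≤ M)
    (hC : V t0 (x t0) * Real.exp (∫ r in (0 : ℝ)..t0, p r) ≤ C)
    (hMC : ∀ s ∈ Icc t0 t,
      M * Real.exp (∫ r in (0 : ℝ)..s, p r) ≤ C * D ^ nJumps γ t0 s) :
    ∀ s ∈ Icc t0 t,
      V s (x s) * Real.exp (∫ r in (0 : ℝ)..s, p r) ≤ C * D ^ nJumps γ t0 s := by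
  have hflow : ∀ a ∈ Icc t0 t, ∀ b ∈ Icc a t, Ioc a b ∩ γ = ∅ →
      V a (x a) * Real.exp (∫ r in (0 : ℝ)..a, p r) ≤ C * D ^ nJumps γ t0 a →
      V b (x b) * Real.exp (∫ r in (0 : ℝ)..b, p r) ≤ C * D ^ nJumps γ t0 b := by
    intro a ha b hb hno hCa
    have hn : ∀ s ∈ Icc a b, nJumps γ t0 s = nJumps γ t0 a := fun s hs => by
      have : nJumps γ a s = 0 := by
        rw [nJumps, (?_ : γ ∩ Ioc a s = ∅), ncard_empty]
        rw [inter_comm]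
        exact subset_empty_iff.1 (hno ▸ inter_subset_inter_left _ (Ioc_subset_Ioc_right hs.2))
      rw [← hγ.nJumps_add ha.1 hs.1, this, add_zero]
    have hlt : ∀ s ≤ t, (s : EReal) < T := fun s hs => (EReal.coe_le_coe_iff.2 hs).trans_lt htT
    rw [hn b ⟨hb.1, le_rfl⟩]
    refine flow_weighted_le (M := M) hγ hp hV.1 hdini (ht0.trans ha.1) hb.1 hno
      (hx.flow a b ha.1 hb.1 (hlt b hb.2) hno).1 (fun s hs => ?_) ?_ hCa fun s hs => ?_
    · exact (hx.flow a s ha.1 hs.1 (hlt s (hs.2.trans hb.2)) (subset_empty_iff.1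
        (hno ▸ inter_subset_inter_left _ (Ioc_subset_Ioc_right hs.2)))).2
    · filter_upwards [hχM] with s hs hm using hs ⟨ha.1.trans_lt hm.1, hm.2.trans hb.2⟩
    · rw [← hn s hs]
      exact hMC s ⟨ha.1.trans hs.1, hs.2.trans hb.2⟩
  suffices H : ∀ k, ∀ s ∈ Icc t0 t, nJumps γ t0 s = k →
      V s (x s) * Real.exp (∫ r in (0 : ℝ)..s, p r) ≤ C * D ^ nJumps γ t0 s from
    fun s hs => H _ s hs rfl
  intro k
  induction k using Nat.strong_induction_on with
  | _ k ih =>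
    rintro s hs rfl
    rcases (γ ∩ Ioc t0 s).eq_empty_or_nonempty with hno | hne
    · exact hflow t0 ⟨le_rfl, hs.1.trans hs.2⟩ s hs (by rwa [inter_comm])
        (by simpa [nJumps_self] using hC)
    obtain ⟨τ, ⟨hτγ, hτs⟩, hmax⟩ :=
      (hγ.finite_inter_Ioc t0 s).isCompact.exists_isGreatest hne
    have hτt : τ ≤ t := hτs.2.trans hs.2
    refine hflow τ ⟨hτs.1.le, hτt⟩ s ⟨hτs.2, hs.2⟩ (eq_empty_of_forall_notMem fun r hr =>
      absurd (hmax ⟨hr.2, hτs.1.trans hr.1.1, hr.1.2⟩) (not_le.2 hr.1.1)) ?_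
    obtain ⟨L, hL, hxτ⟩ := hx.jump τ hτγ hτs.1 ((EReal.coe_le_coe_iff.2 hτt).trans_lt htT)
    have hτ0 : 0 < τ := hγ.1 hτγ
    set E : ℝ → ℝ := fun s => Real.exp (∫ r in (0 : ℝ)..s, p r)
    have hE : 0 < E τ := Real.exp_pos _
    have hnear : ∀ᶠ r in nhdsWithin τ (Iio τ), r ∈ Ioo t0 τ := Ioo_mem_nhdsLT hτs.1
    have hVlim : Tendsto (fun r => V r (x r)) (nhdsWithin τ (Iio τ)) (nhds (Vm τ L)) := by
      refine (hV.2 τ hτγ L).comp (tendsto_nhdsWithin_iff.2 ⟨?_, ?_⟩ :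
        Tendsto (fun r => (r, x r)) _ _)
      · exact (tendsto_id.mono_right nhdsWithin_le_nhds).prodMk_nhds hL
      · filter_upwards [self_mem_nhdsWithin] with r hr using ⟨hr, mem_univ _⟩
    have hVm0 : 0 ≤ Vm τ L := ge_of_tendsto hVlim <| by
      filter_upwards [hnear] with r hr using hV0 r _ (ht0.trans hr.1.le)
    have hD0 : 0 ≤ D := zero_le_one.trans hD
    have hC0 : 0 ≤ C := le_trans (mul_nonneg (hV0 _ _ ht0) (Real.exp_pos _).le) hC
    have hElim : Tendsto E (nhdsWithin τ (Iio τ)) (nhds (E τ)) := by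
      have := (hp.absolutelyContinuousOnInterval_integral (τ - 1) (τ + 1)).rexp.continuousOn
      rw [uIcc_of_le (by linarith)] at this
      exact (this.continuousAt (Icc_mem_nhds (by linarith) (by linarith))).tendsto.mono_left
        nhdsWithin_le_nhds
    rw [hxτ]
    change V τ (L + g τ L (u τ)) * E τ ≤ _
    rcases le_total (χ ‖u τ‖) (Vm τ L) with hcase | hcase
    · have hlim : D * (Vm τ L * E τ) ≤ C * D ^ nJumps γ t0 τ := by
        refine le_of_tendsto ((hVlim.mul hElim).const_mul D) ?_
        filter_upwards [hnear] with r hr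
        have hr1 := hγ.nJumps_succ_le hr.1.le hr.2 hτγ
        have hr2 := hγ.nJumps_add hτs.1.le hτs.2
        have hr3 := ih _ (by omega) r ⟨hr.1.le, hr.2.le.trans hτt⟩ rfl
        calc D * (V r (x r) * E r) ≤ D * (C * D ^ nJumps γ t0 r) := by gcongr
          _ = C * D ^ (nJumps γ t0 r + 1) := by ring
          _ ≤ _ := by gcongr
      calc V τ (L + g τ L (u τ)) * E τ ≤ (D * Vm τ L) * E τ := by
            gcongr
            exact (hjump τ L (u τ) hτγ hcase).trans (by gcongr)
        _ ≤ _ := by rwa [mul_assoc]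
    · calc V τ (L + g τ L (u τ)) * E τ ≤ M * E τ := by
            gcongr
            exact (hjump' τ L (u τ) hτγ hcase).trans (hπM τ hτγ ⟨hτs.1, hτt⟩)
        _ ≤ _ := hMC τ ⟨hτs.1.le, hτt⟩

end Lyapunov

theorem LocIntegrable.exp_integral_le {p : ℝ → ℝ} (hp : LocIntegrable p) {κ c : ℝ}
    (hlin : ∀ w : ℝ → ℝ, IsLinSol p w →
      ∀ t0 t : ℝ, 0 ≤ t0 → t0 ≤ t → |w t| ≤ κ * Real.exp (-(c * (t - t0))) * |w t0|)
    {r t : ℝ} (hr : 0 ≤ r) (hrt : r ≤ t) :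
    Real.exp (∫ s in (0 : ℝ)..r, p s) ≤
      κ * Real.exp (-(c * (t - r))) * Real.exp (∫ s in (0 : ℝ)..t, p s) := by
  have h := hlin _ hp.isLinSol_exp r t hr hrt
  rw [Real.abs_exp, Real.abs_exp, Real.exp_neg (∫ s in (0 : ℝ)..t, p s),
    Real.exp_neg (∫ s in (0 : ℝ)..r, p s), ← div_eq_mul_inv,
    le_div_iff₀ (Real.exp_pos _), inv_mul_le_iff₀ (Real.exp_pos _)] at h
  linarith

theorem exp_mul_pow_le_of_dwellTime {c D τ N Δ : ℝ} {k : ℕ} (hD : 1 ≤ D) (hτ : 0 < τ)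
    (hc : Real.log D / τ ≤ c) (hΔ : 0 ≤ Δ) (hk : (k : ℝ) ≤ N + Δ / τ) :
    Real.exp (-(c * Δ)) * D ^ k ≤
      Real.exp (N * Real.log D + (c - Real.log D / τ) / 2 * τ * N) *
        Real.exp (-(min ((c - Real.log D / τ) / 2) ((c - Real.log D / τ) / 2 * τ) * (Δ + k))) := by
  have hlog : 0 ≤ Real.log D := Real.log_nonneg hD
  set θ := (c - Real.log D / τ) / 2 with hθ
  have hθ0 : 0 ≤ θ := by rw [hθ]; linarith
  rw [← Real.exp_log (zero_lt_one.trans_le hD), ← Real.exp_nat_mul, ← Real.exp_add, ← Real.exp_add,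
    Real.log_exp]
  refine Real.exp_le_exp.2 ?_
  have h1 : k * Real.log D ≤ (N + Δ / τ) * Real.log D := by gcongr
  have h2 : min θ (θ * τ) * Δ ≤ θ * Δ := by gcongr; exact min_le_left _ _
  have h3 : min θ (θ * τ) * k ≤ θ * τ * (N + Δ / τ) := by
    gcongr
    exact min_le_right _ _
  have h4 : θ * τ * (N + Δ / τ) = θ * τ * N + θ * Δ := by field_simp
  have h5 : (N + Δ / τ) * Real.log D = N * Real.log D + (c - 2 * θ) * Δ := by rw [hθ]; ring
  nlinarith

theorem ClassKInf.map_max_le_add {ψ : ℝ → ℝ} (hψ : ClassKInf ψ) {a b : ℝ} (ha : 0 ≤ a)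
    (hb : 0 ≤ b) : ψ (max a b) ≤ ψ a + ψ b := by
  rcases max_choice a b with h | h <;> rw [h]
  · linarith [hψ.nonneg hb]
  · linarith [hψ.nonneg ha]

theorem IsSolution.le_max_of_decay {n m : ℕ} {γ : Set ℝ} {f g : ℝ → Stt n → Stt m → Stt n}
    {V Vm : ℝ → Stt n → ℝ} {p χ π : ℝ → ℝ} {x : ℝ → Stt n} {u : ℝ → Stt m}
    (hγ : IsImpulseSeq γ) (hp : LocIntegrable p)
    (hV : InClassV γ V Vm) (hV0 : ∀ (t : ℝ) (ξ : Stt n), 0 ≤ t → 0 ≤ V t ξ)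
    (hχ : ClassKInf χ) (hπ : ClassKInf π)
    (hdini : ∀ (t : ℝ) (ξ : Stt n) (μ : Stt m), 0 ≤ t → t ∉ γ → χ ‖μ‖ ≤ V t ξ →
      DiniAlong f V t ξ μ ≤ -(p t * V t ξ))
    {d D : ℝ} (hdD : d ≤ D) (hD : 1 ≤ D)
    (hjump : ∀ (t : ℝ) (ξ : Stt n) (μ : Stt m), t ∈ γ → χ ‖μ‖ ≤ Vm t ξ →
      V t (ξ + g t ξ μ) ≤ d * Vm t ξ)
    (hjump' : ∀ (t : ℝ) (ξ : Stt n) (μ : Stt m), t ∈ γ → Vm t ξ ≤ χ ‖μ‖ →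
      V t (ξ + g t ξ μ) ≤ π ‖μ‖)
    {t0 t : ℝ} {x0 : Stt n} {T : EReal} (ht0 : 0 ≤ t0) (htt : t0 ≤ t) (hu : IsInput u)
    (hx : IsSolution γ f g t0 x0 u T x) (htT : (t : EReal) < T)
    {A η : ℝ} (hA : 0 < A) (hη : 0 ≤ η)
    (hdecay : ∀ r ∈ Icc t0 t, Real.exp (∫ s in (0 : ℝ)..r, p s) * D ^ nJumps γ r t ≤
      A * Real.exp (-(η * (t - r + nJumps γ r t))) * Real.exp (∫ s in (0 : ℝ)..t, p s)) :
    V t (x t) ≤ max (A * Real.exp (-(η * (t - t0 + nJumps γ t0 t))) * V t0 x0)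
      (A * (χ (inputNorm γ u (Ioc t0 t)) + π (inputNorm γ u (Ioc t0 t)))) := by
  set U := inputNorm γ u (Ioc t0 t)
  have hU : 0 ≤ U := inputNorm_nonneg _
  set M := χ U + π U
  have hM0 : 0 ≤ M := add_nonneg (hχ.nonneg hU) (hπ.nonneg hU)
  set E : ℝ → ℝ := fun s => Real.exp (∫ r in (0 : ℝ)..s, p r)
  have hE : ∀ s, 0 < E s := fun s => Real.exp_pos _
  have hD0 : 0 < D := zero_lt_one.trans_le hD
  set C := max (V t0 (x t0) * E t0) (M * A * E t / D ^ nJumps γ t0 t) with hCdef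
  have hMC : ∀ s ∈ Icc t0 t, M * E s ≤ C * D ^ nJumps γ t0 s := fun s hs => by
    have h1 : E s * D ^ nJumps γ s t ≤ A * E t := by
      refine (hdecay s hs).trans ?_
      have : Real.exp (-(η * (t - s + nJumps γ s t))) ≤ 1 := by
        have : 0 ≤ t - s := sub_nonneg.2 hs.2
        exact Real.exp_le_one_iff.2 (neg_nonpos.2 (by positivity))
      exact mul_le_mul_of_nonneg_right (mul_le_of_le_one_right hA.le this) (hE t).le
    calc M * E s ≤ M * (A * E t / D ^ nJumps γ s t) := by
          gcongr
          rwa [le_div_iff₀ (by positivity)]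
      _ = M * A * E t / D ^ nJumps γ t0 t * D ^ nJumps γ t0 s := by
          rw [← hγ.nJumps_add hs.1 hs.2, pow_add]
          field_simp
      _ ≤ C * D ^ nJumps γ t0 s := by
          gcongr
          exact le_max_right _ _
  have key := hx.weighted_le hγ hp hV hV0 hdini hdD hD hjump hjump' ht0 htT (M := M) (C := C)
    (by
      filter_upwards [hu.ae_norm_le_inputNorm (γ := γ) (t := t) ht0] with s hs hm
      exact (hχ.mono (norm_nonneg _) (hs hm)).trans (le_add_of_nonneg_right (hπ.nonneg hU)))
    (fun s hs hm => (hπ.mono (norm_nonneg _) (hγ.norm_le_inputNorm hs hm)).trans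
      (le_add_of_nonneg_left (hχ.nonneg hU)))
    (le_max_left _ _) hMC t ⟨htt, le_rfl⟩
  refine le_of_mul_le_mul_right (key.trans ?_) (hE t)
  rw [hCdef, max_mul_of_nonneg _ _ (by positivity), max_mul_of_nonneg _ _ (hE t).le, hx.init]
  refine max_le_max ?_ (le_of_eq ?_)
  · calc V t0 x0 * E t0 * D ^ nJumps γ t0 t = V t0 x0 * (E t0 * D ^ nJumps γ t0 t) := by ring
      _ ≤ V t0 x0 * (A * Real.exp (-(η * (t - t0 + nJumps γ t0 t))) * E t) :=
          mul_le_mul_of_nonneg_left (hdecay t0 ⟨le_rfl, htt⟩) (hV0 t0 x0 ht0)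
      _ = _ := by ring
  · field_simp

/-- Corollary 1(a): strong `(h⁰,h)`-ISS under an average dwell-time condition. -/
theorem stmt6 {n m : ℕ} {Λ : Type*} (γ : Λ → Set ℝ)
    (f g : Λ → ℝ → Stt n → Stt m → Stt n)
    (hγ : ∀ l : Λ, IsImpulseSeq (γ l))
    (h0 h : ℝ → Stt n → ℝ)
    (hh0 : ∀ (t : ℝ) (ξ : Stt n), 0 ≤ t → 0 ≤ h0 t ξ)
    (hh : ∀ (t : ℝ) (ξ : Stt n), 0 ≤ t → 0 ≤ h t ξ)
    (V Vm : Λ → ℝ → Stt n → ℝ) (φ1 φ2 χ π : ℝ → ℝ)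
    (p : Λ → ℝ → ℝ) (d : ℝ) (hd : 0 ≤ d)
    (hpmeas : ∀ l : Λ, Measurable (p l)) (hploc : ∀ l : Λ, LocIntegrable (p l))
    (hA1 : Assumption1 γ f g h0 h V Vm φ1 φ2 χ π
      (fun l t r => p l t * r) (fun _ _ r => d * r))
    (κ c : ℝ) (hκ : 0 < κ)
    (hlin : ∀ (l : Λ) (w : ℝ → ℝ), IsLinSol (p l) w →
      ∀ t0 t : ℝ, 0 ≤ t0 → t0 ≤ t → |w t| ≤ κ * Real.exp (-(c * (t - t0))) * |w t0|)
    (hc : 0 < c) (N0 : ℕ) (τD : ℝ) (hτD : 0 < τD)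
    (hτDlog : 0 < d → Real.log d / c < τD)
    (hADT : ∀ (l : Λ) (s t : ℝ), 0 ≤ s → s < t →
      (nJumps (γ l) s t : ℝ) ≤ (N0 : ℝ) + (t - s) / τD) :
    StronglyISS γ f g h0 h := by
  obtain ⟨hφ1, hφ2, hχ, hπ, hV, -, -, hbd, hdini, hjump, hjump'⟩ := hA1
  obtain ⟨ψ, hψ, hψφ⟩ := hφ1.exists_leftInverse
  have hV0 : ∀ (l : Λ) (t : ℝ) (ξ : Stt n), 0 ≤ t → 0 ≤ V l t ξ := fun l t ξ ht =>
    (hφ1.nonneg (hh t ξ ht)).trans (hbd l t ξ ht).1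
  set D := max d 1
  have hD : 1 ≤ D := le_max_right _ _
  have hlog : Real.log D / τD < c := by
    rcases le_total d 1 with h | h
    · simpa [D, max_eq_right h] using hc
    · have := hτDlog (zero_lt_one.trans_le h)
      rw [div_lt_iff₀ hc] at this
      rw [show D = d from max_eq_left h, div_lt_iff₀ hτD]
      linarith
  set θ := (c - Real.log D / τD) / 2 with hθ
  have hθ0 : 0 < θ := by rw [hθ]; linarith
  set η := min θ (θ * τD) with hη
  have hη0 : 0 < η := lt_min hθ0 (mul_pos hθ0 hτD)
  set B := Real.exp (N0 * Real.log D + θ * τD * N0) with hB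
  have hA : 0 < κ * B := mul_pos hκ (Real.exp_pos _)
  refine ⟨fun r s => ψ (κ * B * Real.exp (-(η * s)) * φ2 r), fun r => ψ (κ * B * (χ r + π r)),
    hψ.classKL_exp_decay hφ2 hA hη0, hψ.comp ((hχ.add hπ).const_mul hA), ?_⟩
  intro l t0 x0 u T x ht0 hu hx t htt htT
  have hnum : ∀ r ∈ Icc t0 t, (nJumps (γ l) r t : ℝ) ≤ N0 + (t - r) / τD := fun r hr => by
    rcases hr.2.eq_or_lt with rfl | h
    · simp [nJumps_self]
    · exact hADT l r t (ht0.trans hr.1) h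
  have hle := hx.1.le_max_of_decay (hγ l) (hploc l) (hV l) (hV0 l) hχ hπ (hdini l)
    (le_max_left d 1) hD (hjump l) (hjump' l) ht0 htt hu htT hA hη0.le fun r hr => by
      have h1 := (hploc l).exp_integral_le (hlin l) (ht0.trans hr.1) hr.2
      have h2 := exp_mul_pow_le_of_dwellTime hD hτD hlog.le (sub_nonneg.2 hr.2) (hnum r hr)
      rw [← hθ, ← hB, ← hη] at h2
      calc _ ≤ κ * Real.exp (-(c * (t - r))) * Real.exp (∫ s in (0 : ℝ)..t, p l s) *
            D ^ nJumps (γ l) r t := by gcongr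
        _ = κ * (Real.exp (-(c * (t - r))) * D ^ nJumps (γ l) r t) *
            Real.exp (∫ s in (0 : ℝ)..t, p l s) := by ring
        _ ≤ κ * (B * Real.exp (-(η * (t - r + nJumps (γ l) r t)))) *
            Real.exp (∫ s in (0 : ℝ)..t, p l s) := by gcongr
        _ = _ := by ring
  have hU : 0 ≤ inputNorm (γ l) u (Ioc t0 t) := inputNorm_nonneg _
  have ht : 0 ≤ t := ht0.trans htt
  have hVφ := (hbd l t0 x0 ht0).2
  rw [← hψφ _ (hh t (x t) ht)]
  refine (hψ.mono (hφ1.nonneg (hh t _ ht)) (((hbd l t _ ht).1.trans hle).trans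
    (max_le_max_right _ (mul_le_mul_of_nonneg_left hVφ (by positivity))))).trans
    (hψ.map_max_le_add ?_ ?_)
  · exact mul_nonneg (by positivity) (hφ2.nonneg (hh0 t0 x0 ht0))
  · exact mul_nonneg hA.le (add_nonneg (hχ.nonneg hU) (hπ.nonneg hU))

end
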